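/- Let E ⊂ ℝ be a weakly homogeneous Borel set, i.e. limsup_{h→0+} |E ∩ (x−h, x+h)|/(2h) > 0 for every x ∈ E. If μ ∈ R(E), then μ_s(E) = 0. -/

import Mathlib

open MeasureTheory Filter Topology

/-- The Herglotz function associated with a positive Borel measure `μ` on `ℝ`
(satisfying `∫ dμ(t)/(t²+1) < ∞`) and constants `a ∈ ℝ`, `b ≥ 0`:
`F(z) = a + b z + ∫ (1/(t - z) - t/(t² + 1)) dμ(t)`. -/
noncomputable def herglotzFn (μ : Measure ℝ) (a b : ℝ) (z : ℂ) : ℂ :=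
  (a : ℂ) + (b : ℂ) * z +
    ∫ t : ℝ, (((t : ℂ) - z)⁻¹ - (t : ℂ) / ((t : ℂ) ^ 2 + 1)) ∂μ

/-- `μ ∈ R(E)`: the measure `μ` satisfies `∫ dμ(t)/(t²+1) < ∞` and for some choice of
`a ∈ ℝ`, `b ≥ 0` the associated Herglotz function `F_μ` is reflectionless on `E`, i.e.
its boundary value has vanishing real part at Lebesgue-a.e. point of `E`. -/
def IsReflectionless (μ : Measure ℝ) (E : Set ℝ) : Prop :=
  Integrable (fun t : ℝ => (t ^ 2 + 1)⁻¹) μ ∧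
  ∃ a b : ℝ, 0 ≤ b ∧
    ∀ᵐ t : ℝ ∂(volume.restrict E),
      Tendsto (fun y : ℝ => (herglotzFn μ a b ((t : ℂ) + y * Complex.I)).re)
        (𝓝[>] (0 : ℝ)) (𝓝 0)

theorem lintegral_closedBall_re_le_of_re_nonneg {G : ℂ → ℂ}
    (hG : ∀ z : ℂ, 0 < z.im → DifferentiableAt ℂ G z) (hpos : ∀ z : ℂ, 0 < z.im → 0 ≤ (G z).re)
    (x : ℝ) {h y : ℝ} (hh : 0 < h) (hy : 0 < y) :
    ∫⁻ t in Metric.closedBall x h, ENNReal.ofReal (G (t + y * Complex.I)).re ≤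
      ENNReal.ofReal (2 * Real.pi * h * (G (x + (y + h : ℝ) * Complex.I)).re) := by
  set φ : ℂ → ℂ := fun ζ => x + y * Complex.I + h * Complex.I * ((1 + ζ) / (1 - ζ)) with hφ
  have hφim : ∀ ζ : ℂ, ‖ζ‖ ≤ 1 → ζ ≠ 1 → 0 < (φ ζ).im := by
    intro ζ h1 h2
    have h3 : (1 - ζ) ≠ 0 := sub_ne_zero.2 (Ne.symm h2)
    have h4 : 0 < Complex.normSq (1 - ζ) := Complex.normSq_pos.2 h3
    have h5 : 0 ≤ ((1 + ζ) / (1 - ζ)).re := by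
      rw [Complex.div_re, ← add_div]
      refine div_nonneg ?_ h4.le
      have : ζ.re * ζ.re + ζ.im * ζ.im ≤ 1 := by
        rw [← Complex.normSq_apply, Complex.normSq_eq_norm_sq]
        nlinarith [norm_nonneg ζ]
      simp
      nlinarith
    have : (φ ζ).im = y + h * ((1 + ζ) / (1 - ζ)).re := by
      simp [hφ, Complex.mul_im]
    rw [this]
    positivity
  set H : ℂ → ℂ := fun ζ => G (φ ζ) with hH
  have hHd : ∀ ζ : ℂ, ‖ζ‖ ≤ 1 → ζ ≠ 1 → DifferentiableAt ℂ H ζ := by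
    intro ζ h1 h2
    have h3 : (1 - ζ) ≠ 0 := sub_ne_zero.2 (Ne.symm h2)
    refine (hG _ (hφim ζ h1 h2)).comp ζ ?_
    simp only [hφ]
    fun_prop (disch := assumption)
  have hne : ∀ r θ : ℝ, 0 ≤ r → r < 1 → ‖circleMap 0 r θ‖ ≤ 1 ∧ circleMap 0 r θ ≠ 1 := by
    intro r θ h0 h1
    have : ‖circleMap 0 r θ‖ = r := by simp [abs_of_nonneg h0]
    refine ⟨by linarith, fun h2 => ?_⟩
    rw [h2] at this
    simp at this
    linarith
  have hcont : ∀ r : ℝ, 0 ≤ r → r < 1 → Continuous fun θ : ℝ => H (circleMap 0 r θ) := by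
    intro r h0 h1
    refine continuous_iff_continuousAt.2 fun θ => ?_
    exact ContinuousAt.comp (f := fun θ : ℝ => circleMap 0 r θ)
      (hHd _ (hne r θ h0 h1).1 (hne r θ h0 h1).2).continuousAt (continuous_circleMap 0 r).continuousAt
  have hmean : ∀ r : ℝ, 0 ≤ r → r < 1 →
      ∫⁻ θ in Set.Ioo 0 (2 * Real.pi), ENNReal.ofReal (H (circleMap 0 r θ)).re ≤
        ENNReal.ofReal (2 * Real.pi * (H 0).re) := by
    intro r h0 h1
    have havg : Real.circleAverage H 0 r = H 0 := by
      apply DiffContOnCl.circleAverage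
      have : ∀ ζ ∈ closure (Metric.ball (0 : ℂ) |r|), DifferentiableAt ℂ H ζ := by
        intro ζ hζ
        have := Metric.closure_ball_subset_closedBall hζ
        rw [mem_closedBall_zero_iff, abs_of_nonneg h0] at this
        refine hHd ζ (by linarith) ?_
        rintro rfl
        simp at this
        linarith
      exact DifferentiableOn.diffContOnCl fun ζ hζ => (this ζ hζ).differentiableWithinAt
    have hint : ∫ θ in (0 : ℝ)..2 * Real.pi, (H (circleMap 0 r θ)).re = 2 * Real.pi * (H 0).re := by
      have h2 : (∫ θ in (0 : ℝ)..2 * Real.pi, H (circleMap 0 r θ)) = (2 * Real.pi : ℝ) • H 0 := by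
        rw [← havg, Real.circleAverage_def, smul_smul, mul_inv_cancel₀ (by positivity), one_smul]
      have h3 := Complex.reCLM.intervalIntegral_comp_comm (μ := volume)
        ((hcont r h0 h1).intervalIntegrable 0 (2 * Real.pi))
      simp only [Complex.reCLM_apply] at h3
      rw [h3, h2]
      simp
    rw [← hint, intervalIntegral.integral_of_le (by positivity),
      ofReal_integral_eq_lintegral_ofReal]
    · exact lintegral_mono_set Set.Ioo_subset_Ioc_self
    · exact Continuous.integrableOn_Ioc (Complex.continuous_re.comp (hcont r h0 h1))
    · exact Eventually.of_forall fun θ => hpos _ (hφim _ (hne r θ h0 h1).1 (hne r θ h0 h1).2)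
  have hrefl : ∀ θ ∈ Set.Ioo 0 (2 * Real.pi), circleMap 0 1 θ ≠ 1 := by
    intro θ hθ h1
    have h2 := congrArg Complex.re h1
    simp [circleMap, Complex.exp_ofReal_mul_I_re] at h2
    have := (Real.cos_eq_one_iff_of_lt_of_lt (by linarith [hθ.1, Real.pi_pos]) hθ.2).1 h2
    linarith [hθ.1]
  have hfatou : ∫⁻ θ in Set.Ioo 0 (2 * Real.pi), ENNReal.ofReal (H (circleMap 0 1 θ)).re ≤
        ENNReal.ofReal (2 * Real.pi * (H 0).re) := by
    have hr0 : ∀ n : ℕ, 0 ≤ 1 - 1 / ((n : ℝ) + 1) := fun n => by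
      rw [sub_nonneg, div_le_one (by positivity)]; simp
    have hr1 : ∀ n : ℕ, 1 - 1 / ((n : ℝ) + 1) < 1 := fun n => by
      have : 0 < 1 / ((n : ℝ) + 1) := by positivity
      linarith
    have hr : Tendsto (fun n : ℕ => 1 - 1 / ((n : ℝ) + 1)) atTop (𝓝 1) := by
      simpa using tendsto_one_div_add_atTop_nhds_zero_nat.const_sub (1 : ℝ)
    calc _ = ∫⁻ θ in Set.Ioo 0 (2 * Real.pi), liminf (fun n : ℕ =>
            ENNReal.ofReal (H (circleMap 0 (1 - 1 / ((n : ℝ) + 1)) θ)).re) atTop := by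
          refine setLIntegral_congr_fun measurableSet_Ioo fun θ hθ => ?_
          refine (Tendsto.liminf_eq ?_).symm
          refine (ENNReal.continuous_ofReal.comp Complex.continuous_re).continuousAt.tendsto.comp ?_
          refine (hHd _ (by simp) (hrefl θ hθ)).continuousAt.tendsto.comp ?_
          have : Continuous fun r : ℝ => circleMap 0 r θ := by unfold circleMap; fun_prop
          exact (this.tendsto 1).comp hr
      _ ≤ liminf (fun n : ℕ => ∫⁻ θ in Set.Ioo 0 (2 * Real.pi),
            ENNReal.ofReal (H (circleMap 0 (1 - 1 / ((n : ℝ) + 1)) θ)).re) atTop := by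
          refine lintegral_liminf_le fun n => ?_
          exact (ENNReal.continuous_ofReal.comp
            (Complex.continuous_re.comp (hcont _ (hr0 n) (hr1 n)))).measurable
      _ ≤ _ := by
          refine liminf_le_of_le (by isBoundedDefault) fun b hb => ?_
          obtain ⟨n, hn⟩ := hb.exists
          exact hn.trans (hmean _ (hr0 n) (hr1 n))
  set g : ℝ → ℝ := fun t => 2 * Real.arctan ((t - x) / h) + Real.pi with hg
  have hgd : ∀ t : ℝ, HasDerivAt g (2 * h / (h ^ 2 + (t - x) ^ 2)) t := by
    intro t
    have h1 : HasDerivAt (fun t : ℝ => (t - x) / h) (1 / h) t :=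
      ((hasDerivAt_id t).sub_const x).div_const h
    convert! (h1.arctan.const_mul 2).add_const Real.pi using 1
    field_simp
  have hginj : Function.Injective g := by
    intro s t hst
    have := Real.arctan_injective (mul_left_cancel₀ two_ne_zero (add_right_cancel hst))
    field_simp at this
    linarith
  have hgmem : ∀ t, g t ∈ Set.Ioo 0 (2 * Real.pi) := fun t =>
    ⟨by have := Real.neg_pi_div_two_lt_arctan ((t - x) / h); simp only [hg]; linarith,
      by have := Real.arctan_lt_pi_div_two ((t - x) / h); simp only [hg]; linarith⟩
  have hφg : ∀ t : ℝ, φ (circleMap 0 1 (g t)) = t + y * Complex.I := by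
    intro t
    set s := (t - x) / h with hs
    have hζ : circleMap 0 1 (g t) =
        (-((1 - s ^ 2) / (1 + s ^ 2)) : ℝ) + (-(2 * s / (1 + s ^ 2)) : ℝ) * Complex.I := by
      have hc := Real.cos_sq_arctan s
      have hsin : Real.sin (Real.arctan s) = s * Real.cos (Real.arctan s) := by
        rw [Real.sin_arctan, Real.cos_arctan]; ring
      simp only [circleMap, hg, ← hs, zero_add, Complex.ofReal_one, one_mul, Complex.exp_mul_I,
        ← Complex.ofReal_cos, ← Complex.ofReal_sin, Real.cos_add_pi, Real.sin_add_pi,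
        Real.cos_two_mul, Real.sin_two_mul, hsin, hc]
      have h1 : 2 * (s * Real.cos (Real.arctan s)) * Real.cos (Real.arctan s) =
          2 * s / (1 + s ^ 2) := by
        rw [show 2 * (s * Real.cos (Real.arctan s)) * Real.cos (Real.arctan s) =
          2 * s * Real.cos (Real.arctan s) ^ 2 by ring, hc]
        ring
      have h2 : 2 * (1 / (1 + s ^ 2)) - 1 = (1 - s ^ 2) / (1 + s ^ 2) := by
        field_simp; ring
      rw [h1, h2]
    have hne1 : 1 - circleMap 0 1 (g t) ≠ 0 := sub_ne_zero.2 (hrefl _ (hgmem t)).symm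
    have hI : Complex.I * ((1 + circleMap 0 1 (g t)) / (1 - circleMap 0 1 (g t))) = s := by
      rw [← mul_div_assoc, div_eq_iff hne1, hζ]
      have h0 : 1 + s ^ 2 ≠ 0 := by positivity
      apply Complex.ext
      · have : 2 * s / (1 + s ^ 2) = s * (1 + (1 - s ^ 2) / (1 + s ^ 2)) := by
          field_simp; ring
        rw [Complex.I_mul_re, Complex.re_ofReal_mul]
        simpa only [Complex.add_im, Complex.sub_re, Complex.add_re, Complex.one_re, Complex.one_im,
          Complex.ofReal_re, Complex.ofReal_im, Complex.re_ofReal_mul, Complex.im_ofReal_mul,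
          Complex.I_re, Complex.I_im, mul_one, mul_zero, add_zero, zero_add, neg_neg,
          sub_neg_eq_add] using this
      · have : 1 - (1 - s ^ 2) / (1 + s ^ 2) = s * (2 * s / (1 + s ^ 2)) := by
          field_simp; ring
        rw [Complex.I_mul_im, Complex.im_ofReal_mul]
        simpa only [Complex.add_re, Complex.sub_im, Complex.add_im, Complex.one_re, Complex.one_im,
          Complex.ofReal_re, Complex.ofReal_im, Complex.re_ofReal_mul, Complex.im_ofReal_mul,
          Complex.I_re, Complex.I_im, mul_one, mul_zero, add_zero, zero_add, zero_sub, neg_neg,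
          ← sub_eq_add_neg] using this
    have hst : (h : ℂ) * s = t - x := by
      rw [hs]; push_cast
      field_simp [Complex.ofReal_ne_zero.2 hh.ne']
    simp only [hφ, mul_assoc, hI, hst]
    ring
  have hφ0 : φ 0 = x + (y + h : ℝ) * Complex.I := by
    simp [hφ]; ring
  have hchange : ∫⁻ t in Metric.closedBall x h, ENNReal.ofReal (2 * h / (h ^ 2 + (t - x) ^ 2)) *
      ENNReal.ofReal (G (t + y * Complex.I)).re ≤ ENNReal.ofReal (2 * Real.pi * (H 0).re) := by
    refine le_trans (le_of_eq ?_) ((lintegral_mono_set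
      (s := g '' Metric.closedBall x h) ?_).trans hfatou)
    · rw [lintegral_image_eq_lintegral_abs_deriv_mul measurableSet_closedBall
        (fun t _ => (hgd t).hasDerivWithinAt) hginj.injOn]
      refine lintegral_congr fun t => ?_
      simp only [hH, abs_of_nonneg (show 0 ≤ 2 * h / (h ^ 2 + (t - x) ^ 2) by positivity), hφg]
    · rintro _ ⟨t, -, rfl⟩
      exact hgmem t
  calc _ ≤ ∫⁻ t in Metric.closedBall x h, ENNReal.ofReal h *
        (ENNReal.ofReal (2 * h / (h ^ 2 + (t - x) ^ 2)) *
          ENNReal.ofReal (G (t + y * Complex.I)).re) := by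
        refine setLIntegral_mono' measurableSet_closedBall fun t ht => ?_
        rw [← mul_assoc, ← ENNReal.ofReal_mul hh.le]
        refine le_mul_of_one_le_left' ?_
        rw [ENNReal.one_le_ofReal, ← mul_div_assoc, le_div_iff₀ (by positivity)]
        rw [Metric.mem_closedBall, Real.dist_eq] at ht
        have := sq_le_sq' (abs_le.1 ht).1 (abs_le.1 ht).2
        linarith
    _ ≤ ENNReal.ofReal h * ENNReal.ofReal (2 * Real.pi * (H 0).re) := by
        rw [lintegral_const_mul' _ _ ENNReal.ofReal_ne_top]
        gcongr
    _ = _ := by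
        simp only [← ENNReal.ofReal_mul hh.le, hH, hφ0]
        congr 1; ring

theorem re_cpow_half_nonneg (w : ℂ) : 0 ≤ (w ^ (2⁻¹ : ℂ)).re := by
  rcases eq_or_ne w 0 with rfl | hw
  · simp
  rw [Complex.cpow_def_of_ne_zero hw, Complex.exp_re]
  refine mul_nonneg (Real.exp_nonneg _) (Real.cos_nonneg_of_mem_Icc ?_)
  have : (Complex.log w * 2⁻¹).im = w.arg / 2 := by
    rw [show (2⁻¹ : ℂ) = ((2⁻¹ : ℝ) : ℂ) by simp, mul_comm, Complex.im_ofReal_mul, Complex.log_im]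
    ring
  rw [this]
  constructor <;> linarith [Complex.arg_le_pi w, Complex.neg_pi_lt_arg w]

theorem volume_closedBall_inter_norm_le_le {f : ℂ → ℂ}
    (hf : ∀ z : ℂ, 0 < z.im → DifferentiableAt ℂ f z) (him : ∀ z : ℂ, 0 < z.im → 0 < (f z).im)
    (x : ℝ) {h y κ : ℝ} (hh : 0 < h) (hy : 0 < y) (hκ : 0 < κ) :
    volume {t ∈ Metric.closedBall x h | ‖f (t + y * Complex.I)‖ ≤ κ} ≤
      ENNReal.ofReal (4 * Real.pi * h * √(κ / (f (x + (y + h : ℝ) * Complex.I)).im)) := by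
  set G : ℂ → ℂ := fun z => (-Complex.I * f z)⁻¹ ^ (2⁻¹ : ℂ) with hG
  have hre : ∀ z : ℂ, 0 < z.im → 0 < ((-Complex.I * f z)⁻¹).re := by
    intro z hz
    have h1 : 0 < (-Complex.I * f z).re := by simpa using him z hz
    rw [Complex.inv_re]
    exact div_pos h1 (Complex.normSq_pos.2 fun h0 => by simp [h0] at h1)
  have hGd : ∀ z : ℂ, 0 < z.im → DifferentiableAt ℂ G z := by
    intro z hz
    refine DifferentiableAt.cpow_const (((hf z hz).const_mul _).inv ?_) (Or.inl (hre z hz))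
    intro h0
    have := hre z hz
    simp [h0] at this
  have hGsq : ∀ z : ℂ, G z ^ 2 = (-Complex.I * f z)⁻¹ := fun z =>
    Complex.cpow_ofNat_inv_pow _ 2
  have hGnorm : ∀ z : ℂ, (G z).re ^ 2 + (G z).im ^ 2 = ‖f z‖⁻¹ := by
    intro z
    have := congrArg norm (hGsq z)
    rw [norm_pow, ← Complex.normSq_eq_norm_sq, Complex.normSq_apply] at this
    simp at this
    linarith
  have hGre : ∀ z : ℂ, 0 < z.im → (G z).im ^ 2 ≤ (G z).re ^ 2 := by
    intro z hz
    have := hre z hz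
    rw [← hGsq z, sq, Complex.mul_re] at this
    nlinarith
  have hG0 : ∀ z, 0 ≤ (G z).re := fun z => re_cpow_half_nonneg _
  have key := lintegral_closedBall_re_le_of_re_nonneg hGd (fun z _ => hG0 z) x hh hy
  set z₀ : ℂ := x + (y + h : ℝ) * Complex.I with hz₀
  have hz₀im : 0 < z₀.im := by simp [hz₀]; positivity
  have hup : (G z₀).re ≤ √((f z₀).im)⁻¹ := by
    apply Real.le_sqrt_of_sq_le
    have h1 := hGnorm z₀
    have h2 : ‖f z₀‖⁻¹ ≤ ((f z₀).im)⁻¹ :=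
      inv_anti₀ (him _ hz₀im) ((le_abs_self _).trans (Complex.abs_im_le_norm _))
    nlinarith [sq_nonneg (G z₀).im]
  have hlow : ∀ t ∈ {t ∈ Metric.closedBall x h | ‖f (t + y * Complex.I)‖ ≤ κ},
      √(2 * κ)⁻¹ ≤ (G (t + y * Complex.I)).re := by
    rintro t ⟨-, ht⟩
    have hz : 0 < ((t : ℂ) + y * Complex.I).im := by simpa using hy
    rw [Real.sqrt_le_left (hG0 _)]
    have h1 := hGnorm (t + y * Complex.I)
    have h2 := hGre _ hz
    have h3 : κ⁻¹ ≤ ‖f (t + y * Complex.I)‖⁻¹ := by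
      refine inv_anti₀ (norm_pos_iff.2 fun h0 => ?_) ht
      have := him _ hz
      simp [h0] at this
    rw [mul_inv]
    linarith
  set A := {t ∈ Metric.closedBall x h | ‖f (t + y * Complex.I)‖ ≤ κ} with hA
  have hcheb : ENNReal.ofReal √(2 * κ)⁻¹ * volume A ≤
      ENNReal.ofReal (2 * Real.pi * h * √((f z₀).im)⁻¹) := by
    calc _ = ∫⁻ t in A, ENNReal.ofReal √(2 * κ)⁻¹ := by rw [setLIntegral_const]
      _ ≤ ∫⁻ t in A, ENNReal.ofReal (G (t + y * Complex.I)).re := by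
        refine lintegral_mono_ae ((ae_restrict_iff' ?_).2
          (Eventually.of_forall fun t ht => ENNReal.ofReal_le_ofReal (hlow t ht)))
        have hc : Continuous fun t : ℝ => f (t + y * Complex.I) :=
          continuous_iff_continuousAt.2 fun t => ContinuousAt.comp
            (f := fun t : ℝ => (t : ℂ) + y * Complex.I)
            (hf _ (by simpa using hy)).continuousAt (by fun_prop)
        exact measurableSet_closedBall.inter (measurableSet_le hc.norm.measurable measurable_const)
      _ ≤ ∫⁻ t in Metric.closedBall x h, ENNReal.ofReal (G (t + y * Complex.I)).re :=
        lintegral_mono_set fun t ht => ht.1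
      _ ≤ _ := key.trans (ENNReal.ofReal_le_ofReal (by gcongr))
  have hfin : volume A = ENNReal.ofReal √(2 * κ) * (ENNReal.ofReal √(2 * κ)⁻¹ * volume A) := by
    rw [← mul_assoc, ← ENNReal.ofReal_mul (by positivity), ← Real.sqrt_mul (by positivity),
      mul_inv_cancel₀ (by positivity)]
    simp
  rw [hfin]
  refine (mul_le_mul_right hcheb _).trans ?_
  rw [← ENNReal.ofReal_mul (by positivity)]
  refine ENNReal.ofReal_le_ofReal ?_
  have h2 : √(2 * κ) = √2 * √κ := Real.sqrt_mul (by norm_num) _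
  have h3 : √2 ≤ 2 := by rw [Real.sqrt_le_left] <;> norm_num
  rw [h2, div_eq_mul_inv, Real.sqrt_mul hκ.le]
  calc _ = √2 * (2 * Real.pi * h * (√κ * √((f z₀).im)⁻¹)) := by ring
    _ ≤ 2 * (2 * Real.pi * h * (√κ * √((f z₀).im)⁻¹)) := by gcongr
    _ = _ := by ring

theorem ofReal_sub_ne_zero_of_im_pos {z : ℂ} (hz : 0 < z.im) (t : ℝ) : (t : ℂ) - z ≠ 0 := by
  intro h0
  have := congrArg Complex.im h0
  simp at this
  linarith

theorem exists_sq_add_one_le_mul_normSq_sub {z : ℂ} (hz : 0 < z.im) :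
    ∃ K : ℝ, 0 < K ∧ ∀ t : ℝ, t ^ 2 + 1 ≤ K * ‖(t : ℂ) - z‖ ^ 2 := by
  refine ⟨2 + (1 + 2 * z.re ^ 2) / z.im ^ 2, by positivity, fun t => ?_⟩
  have h1 : ‖(t : ℂ) - z‖ ^ 2 = (t - z.re) ^ 2 + z.im ^ 2 := by
    rw [← Complex.normSq_eq_norm_sq, Complex.normSq_apply]
    simp
    ring
  rw [h1]
  have h2 : (1 + 2 * z.re ^ 2) / z.im ^ 2 * z.im ^ 2 = 1 + 2 * z.re ^ 2 := by field_simp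
  have h3 : 0 ≤ (1 + 2 * z.re ^ 2) / z.im ^ 2 * (t - z.re) ^ 2 := by positivity
  nlinarith [sq_nonneg (t - 2 * z.re), sq_nonneg z.im]

theorem norm_ofReal_sq_add_one (t : ℝ) : ‖((t : ℂ) ^ 2 + 1)‖ = t ^ 2 + 1 := by
  rw [show (t : ℂ) ^ 2 + 1 = ((t ^ 2 + 1 : ℝ) : ℂ) by push_cast; rfl, Complex.norm_real,
    Real.norm_of_nonneg (by positivity)]

theorem integrable_herglotz_kernel {μ : Measure ℝ} (hμ : Integrable (fun t : ℝ => (t ^ 2 + 1)⁻¹) μ)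
    {z : ℂ} (hz : 0 < z.im) :
    Integrable (fun t : ℝ => ((t : ℂ) - z)⁻¹ - (t : ℂ) / ((t : ℂ) ^ 2 + 1)) μ := by
  refine (hμ.const_mul (‖1 + z ^ 2‖ / z.im + ‖z‖)).mono'
    (by fun_prop) (Eventually.of_forall fun t => ?_)
  have h1 := ofReal_sub_ne_zero_of_im_pos hz t
  have h2 : (t : ℂ) ^ 2 + 1 ≠ 0 := by
    rw [← norm_pos_iff, norm_ofReal_sq_add_one]; positivity
  have h3 : ((t : ℂ) - z)⁻¹ - (t : ℂ) / ((t : ℂ) ^ 2 + 1) =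
      ((1 + z ^ 2) / (t - z) + z) * ((t : ℂ) ^ 2 + 1)⁻¹ := by
    field_simp; ring
  rw [h3, norm_mul, norm_inv, norm_ofReal_sq_add_one]
  gcongr
  refine (norm_add_le _ _).trans ?_
  rw [norm_div]
  gcongr
  have := Complex.abs_im_le_norm ((t : ℂ) - z)
  simpa [abs_of_pos hz] using this

theorem differentiableAt_herglotzFn {μ : Measure ℝ}
    (hμ : Integrable (fun t : ℝ => (t ^ 2 + 1)⁻¹) μ) (a b : ℝ) {z : ℂ} (hz : 0 < z.im) :
    DifferentiableAt ℂ (herglotzFn μ a b) z := by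
  obtain ⟨K, hK, hKle⟩ := exists_sq_add_one_le_mul_normSq_sub hz
  have hball : ∀ w ∈ Metric.ball z (z.im / 2), 0 < w.im ∧ ∀ t : ℝ, ‖(t : ℂ) - z‖ ≤ 2 * ‖(t : ℂ) - w‖ := by
    intro w hw
    rw [Metric.mem_ball, dist_eq_norm] at hw
    have h1 := (Complex.abs_im_le_norm (w - z)).trans hw.le
    rw [Complex.sub_im, abs_le] at h1
    refine ⟨by linarith, fun t => ?_⟩
    have h2 := Complex.abs_im_le_norm ((t : ℂ) - w)
    simp at h2
    have h3 := le_abs_self w.im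
    have h4 : ‖(t : ℂ) - z‖ ≤ ‖(t : ℂ) - w‖ + ‖w - z‖ := norm_sub_le_norm_sub_add_norm_sub _ _ _
    linarith
  have hd := hasDerivAt_integral_of_dominated_loc_of_deriv_le (𝕜 := ℂ) (μ := μ) (x₀ := z)
    (F := fun z t => ((t : ℂ) - z)⁻¹ - (t : ℂ) / ((t : ℂ) ^ 2 + 1))
    (F' := fun z t => (((t : ℂ) - z) ^ 2)⁻¹) (bound := fun t : ℝ => 4 * K * (t ^ 2 + 1)⁻¹)
    (Metric.ball_mem_nhds z (half_pos hz))
    (Eventually.of_forall fun w => by fun_prop) (integrable_herglotz_kernel hμ hz)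
    (by fun_prop) ?_ (hμ.const_mul _) ?_
  · exact ((differentiableAt_const _).add (differentiableAt_id.const_mul _)).add
      hd.2.differentiableAt
  · refine Eventually.of_forall fun t w hw => ?_
    have h1 := (hball w hw).2 t
    have h2 := hKle t
    have h3 : 0 < ‖(t : ℂ) - w‖ := norm_pos_iff.2 (ofReal_sub_ne_zero_of_im_pos (hball w hw).1 t)
    rw [norm_inv, norm_pow, ← div_eq_mul_inv, le_div_iff₀ (by positivity), inv_mul_le_iff₀ (by positivity)]
    have h4 : ‖(t : ℂ) - z‖ ^ 2 ≤ (2 * ‖(t : ℂ) - w‖) ^ 2 := by gcongr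
    nlinarith
  · refine Eventually.of_forall fun t w hw => ?_
    have h3 := ofReal_sub_ne_zero_of_im_pos (hball w hw).1 t
    convert! (((hasDerivAt_id w).const_sub (t : ℂ)).inv h3).sub_const
      ((t : ℂ) / ((t : ℂ) ^ 2 + 1)) using 1
    simp

theorem integrable_poisson_kernel {μ : Measure ℝ}
    (hμ : Integrable (fun t : ℝ => (t ^ 2 + 1)⁻¹) μ) {y : ℝ} (x : ℝ) (hy : 0 < y) :
    Integrable (fun s : ℝ => y / ((s - x) ^ 2 + y ^ 2)) μ ∧
      ∀ a b : ℝ, (herglotzFn μ a b (x + y * Complex.I)).im =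
        b * y + ∫ s : ℝ, y / ((s - x) ^ 2 + y ^ 2) ∂μ := by
  have hz : 0 < ((x : ℂ) + y * Complex.I).im := by simpa using hy
  have him : ∀ s : ℝ, (((s : ℂ) - (x + y * Complex.I))⁻¹ - (s : ℂ) / ((s : ℂ) ^ 2 + 1)).im =
      y / ((s - x) ^ 2 + y ^ 2) := by
    intro s
    have h1 : ((s : ℂ) / ((s : ℂ) ^ 2 + 1)).im = 0 := by
      rw [show (s : ℂ) / ((s : ℂ) ^ 2 + 1) = ((s / (s ^ 2 + 1) : ℝ) : ℂ) by push_cast; rfl,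
        Complex.ofReal_im]
    rw [Complex.sub_im, h1, Complex.inv_im, Complex.normSq_apply]
    simp
    ring
  have hint := integrable_herglotz_kernel hμ hz
  refine ⟨by simpa only [him, Complex.imCLM_apply] using Complex.imCLM.integrable_comp hint,
    fun a b => ?_⟩
  have h2 := Complex.imCLM.integral_comp_comm hint
  simp only [Complex.imCLM_apply, him] at h2
  rw [herglotzFn, Complex.add_im, ← h2]
  simp

theorem lintegral_poisson_kernel_le (s : ℝ) {y : ℝ} (hy : 0 < y) (A : Set ℝ) :
    ∫⁻ t in A, ENNReal.ofReal (y / ((s - t) ^ 2 + y ^ 2)) ≤ ENNReal.ofReal Real.pi := by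
  have h0 : ∀ t : ℝ, y / ((s - t) ^ 2 + y ^ 2) = y⁻¹ * (1 + ((t - s) / y) ^ 2)⁻¹ := by
    intro t; field_simp; ring
  have h1 : Integrable (fun t : ℝ => y⁻¹ * (1 + ((t - s) / y) ^ 2)⁻¹) :=
    ((integrable_inv_one_add_sq.comp_div hy.ne').comp_sub_right s).const_mul _
  have h2 : ∫ t : ℝ, y⁻¹ * (1 + ((t - s) / y) ^ 2)⁻¹ = Real.pi := by
    rw [integral_const_mul, integral_sub_right_eq_self (fun t : ℝ => (1 + (t / y) ^ 2)⁻¹) s,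
      Measure.integral_comp_div (fun t : ℝ => (1 + t ^ 2)⁻¹) y, integral_univ_inv_one_add_sq,
      abs_of_pos hy, smul_eq_mul, inv_mul_cancel_left₀ hy.ne']
  refine (setLIntegral_le_lintegral _ _).trans ?_
  simp only [h0]
  rw [← ofReal_integral_eq_lintegral_ofReal h1
    (Eventually.of_forall fun t => by positivity), h2]

theorem exists_tendsto_zero_lintegral_im_herglotzFn_le {μ : Measure ℝ} [SFinite μ]
    (hμ : Integrable (fun t : ℝ => (t ^ 2 + 1)⁻¹) μ) (a : ℝ) {b : ℝ} (hb : 0 ≤ b) {A : Set ℝ}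
    (hA : IsCompact A) :
    ∃ e : ℝ → ENNReal, Tendsto e (𝓝[>] 0) (𝓝 0) ∧ ∀ y : ℝ, 0 < y →
      ∫⁻ t in A, ENNReal.ofReal (herglotzFn μ a b (t + y * Complex.I)).im ≤
        ENNReal.ofReal Real.pi * μ A + e y := by
  set K : ℝ → ℝ → ENNReal :=
    fun y s => ∫⁻ t in A, ENNReal.ofReal (y / ((s - t) ^ 2 + y ^ 2)) with hK
  have hKm : ∀ y, Measurable (K y) := fun y => by
    refine Measurable.lintegral_prod_right' (f := fun p : ℝ × ℝ =>
      ENNReal.ofReal (y / ((p.1 - p.2) ^ 2 + y ^ 2))) ?_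
    fun_prop
  have hAfin : volume A ≠ ⊤ := hA.measure_lt_top.ne
  obtain ⟨R, hR⟩ := hA.isBounded.subset_closedBall 0
  have hR' : ∀ t ∈ A, t ^ 2 ≤ R ^ 2 := by
    intro t ht
    have := hR ht
    rw [mem_closedBall_zero_iff, Real.norm_eq_abs] at this
    exact sq_le_sq' (abs_le.1 this).1 (abs_le.1 this).2
  have hlim : Tendsto (fun y => ∫⁻ s in Aᶜ, K y s ∂μ) (𝓝[>] 0) (𝓝 0) := by
    have := tendsto_lintegral_filter_of_dominated_convergence (μ := μ.restrict Aᶜ) (l := 𝓝[>] (0 : ℝ))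
      (F := K) (f := fun _ => 0)
      (fun s => ENNReal.ofReal (s ^ 2 + 1)⁻¹ *
        (ENNReal.ofReal (1 + 2 * R ^ 2) * ENNReal.ofReal Real.pi + 2 * volume A))
      (Eventually.of_forall hKm) ?_ ?_ ?_
    · simpa using this
    · filter_upwards [Ioo_mem_nhdsGT (zero_lt_one' ℝ)] with y hy
      refine Eventually.of_forall fun s => ?_
      have hy0 : 0 < y := hy.1
      calc K y s ≤ ∫⁻ t in A, ENNReal.ofReal (s ^ 2 + 1)⁻¹ * (ENNReal.ofReal (1 + 2 * R ^ 2) *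
            ENNReal.ofReal (y / ((s - t) ^ 2 + y ^ 2)) + 2) := by
            refine setLIntegral_mono' hA.measurableSet fun t ht => ?_
            have h2 : (2 : ENNReal) = ENNReal.ofReal 2 := by simp
            rw [h2, ← ENNReal.ofReal_mul (by positivity), ← ENNReal.ofReal_add (by positivity)
              (by positivity), ← ENNReal.ofReal_mul (by positivity)]
            refine ENNReal.ofReal_le_ofReal ?_
            rw [inv_mul_eq_div, le_div_iff₀ (by positivity), ← mul_div_assoc,
              div_add' _ _ _ (by positivity), div_mul_eq_mul_div]
            gcongr
            have h3 := hR' t ht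
            have h4 : s ^ 2 + 1 ≤ 1 + 2 * R ^ 2 + 2 * (s - t) ^ 2 := by
              nlinarith [sq_nonneg (s - 2 * t)]
            have h5 : y * (s ^ 2 + 1) ≤ y * (1 + 2 * R ^ 2 + 2 * (s - t) ^ 2) := by gcongr
            nlinarith [mul_nonneg (sub_nonneg.2 hy.2.le) (sq_nonneg (s - t)), sq_nonneg y]
        _ = ENNReal.ofReal (s ^ 2 + 1)⁻¹ * (ENNReal.ofReal (1 + 2 * R ^ 2) * K y s
            + 2 * volume A) := by
            rw [lintegral_const_mul' _ _ ENNReal.ofReal_ne_top,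
              lintegral_add_right _ measurable_const,
              lintegral_const_mul' _ _ ENNReal.ofReal_ne_top, setLIntegral_const]
        _ ≤ _ := by
            gcongr
            exact lintegral_poisson_kernel_le s hy0 A
    · rw [lintegral_mul_const' _ _ (by finiteness)]
      refine ENNReal.mul_ne_top ?_ (by finiteness)
      refine ne_top_of_le_ne_top ?_ (setLIntegral_le_lintegral _ _)
      rw [← ofReal_integral_eq_lintegral_ofReal hμ (Eventually.of_forall fun t => by positivity)]
      exact ENNReal.ofReal_ne_top
    · refine (ae_restrict_iff' hA.measurableSet.compl).2 (Eventually.of_forall fun s hs => ?_)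
      obtain ⟨d, hd, hds⟩ := Metric.isOpen_iff.1 hA.isClosed.isOpen_compl s hs
      have hle : ∀ t ∈ A, d ≤ |s - t| := by
        intro t ht
        by_contra! hlt
        exact hds (by rwa [Metric.mem_ball, dist_comm, Real.dist_eq]) ht
      have hb : Tendsto (fun y : ℝ => ENNReal.ofReal (y / d ^ 2) * volume A) (𝓝[>] 0) (𝓝 0) := by
        have h1 : Tendsto (fun y : ℝ => ENNReal.ofReal (y / d ^ 2)) (𝓝[>] 0) (𝓝 0) := by
          have : Continuous fun y : ℝ => ENNReal.ofReal (y / d ^ 2) :=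
            ENNReal.continuous_ofReal.comp (by fun_prop)
          simpa using (this.tendsto 0).mono_left nhdsWithin_le_nhds
        simpa using ENNReal.Tendsto.mul_const h1 (Or.inr hAfin)
      refine tendsto_of_tendsto_of_tendsto_of_le_of_le' tendsto_const_nhds hb
        (Eventually.of_forall fun _ => zero_le) ?_
      filter_upwards [self_mem_nhdsWithin] with y hy
      have hy0 : 0 < y := hy
      rw [← setLIntegral_const]
      refine setLIntegral_mono' hA.measurableSet fun t ht => ENNReal.ofReal_le_ofReal ?_
      gcongr
      have := hle t ht
      rw [← sq_abs (s - t)]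
      nlinarith [sq_nonneg y]
  refine ⟨fun y => ENNReal.ofReal (b * y) * volume A + ∫⁻ s in Aᶜ, K y s ∂μ, ?_, fun y hy => ?_⟩
  · have h1 : Tendsto (fun y : ℝ => ENNReal.ofReal (b * y)) (𝓝[>] 0) (𝓝 0) := by
      have : Continuous fun y : ℝ => ENNReal.ofReal (b * y) :=
        ENNReal.continuous_ofReal.comp (by fun_prop)
      simpa using (this.tendsto 0).mono_left nhdsWithin_le_nhds
    simpa using (ENNReal.Tendsto.mul_const h1 (Or.inr hAfin)).add hlim
  · have him : ∀ t : ℝ, ENNReal.ofReal (herglotzFn μ a b (t + y * Complex.I)).im =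
        ENNReal.ofReal (b * y) + ∫⁻ s, ENNReal.ofReal (y / ((s - t) ^ 2 + y ^ 2)) ∂μ := by
      intro t
      obtain ⟨h1, h2⟩ := integrable_poisson_kernel hμ t hy
      have h3 : ∀ s : ℝ, 0 ≤ y / ((s - t) ^ 2 + y ^ 2) := fun s => by positivity
      rw [h2, ENNReal.ofReal_add (by positivity) (integral_nonneg h3),
        ofReal_integral_eq_lintegral_ofReal h1 (Eventually.of_forall h3)]
    have hswap : ∫⁻ t in A, ∫⁻ s, ENNReal.ofReal (y / ((s - t) ^ 2 + y ^ 2)) ∂μ =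
        ∫⁻ s, K y s ∂μ := by
      refine lintegral_lintegral_swap (Measurable.aemeasurable ?_)
      simp only [Function.uncurry_def]
      fun_prop
    have hKA : ∫⁻ s in A, K y s ∂μ ≤ ENNReal.ofReal Real.pi * μ A := by
      rw [← setLIntegral_const]
      exact lintegral_mono fun s => lintegral_poisson_kernel_le s hy A
    simp only [him]
    rw [lintegral_add_left measurable_const, setLIntegral_const, hswap,
      ← lintegral_add_compl _ hA.measurableSet, add_left_comm]
    gcongr

theorem isLocallyFiniteMeasure_of_integrable_inv_sq_add_one {μ : Measure ℝ}
    (hμ : Integrable (fun t : ℝ => (t ^ 2 + 1)⁻¹) μ) : IsLocallyFiniteMeasure μ := by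
  refine ⟨fun x => ⟨{t : ℝ | (x ^ 2 + 2)⁻¹ < (t ^ 2 + 1)⁻¹}, ?_,
    hμ.measure_gt_lt_top (by positivity)⟩⟩
  have hc : Continuous fun t : ℝ => (t ^ 2 + 1)⁻¹ :=
    Continuous.inv₀ (by fun_prop) fun t => by positivity
  refine (isOpen_lt continuous_const hc).mem_nhds ?_
  rw [Set.mem_ofPred_eq]
  gcongr
  norm_num

theorem im_herglotzFn_pos {μ : Measure ℝ} (hμ : Integrable (fun t : ℝ => (t ^ 2 + 1)⁻¹) μ)
    (hμ0 : μ ≠ 0) (a : ℝ) {b : ℝ} (hb : 0 ≤ b) {z : ℂ} (hz : 0 < z.im) :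
    0 < (herglotzFn μ a b z).im := by
  obtain ⟨h1, h2⟩ := integrable_poisson_kernel hμ z.re hz
  have h3 := h2 a b
  rw [Complex.re_add_im] at h3
  rw [h3]
  have hpos : ∀ s : ℝ, 0 < z.im / ((s - z.re) ^ 2 + z.im ^ 2) := fun s => by positivity
  refine add_pos_of_nonneg_of_pos (by positivity) ?_
  rw [integral_pos_iff_support_of_nonneg (fun s => (hpos s).le) h1,
    Function.support_eq_univ fun s => (hpos s).ne']
  exact Measure.measure_univ_pos.2 hμ0

theorem le_im_herglotzFn {μ : Measure ℝ} (hμ : Integrable (fun t : ℝ => (t ^ 2 + 1)⁻¹) μ)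
    (a : ℝ) {b : ℝ} (hb : 0 ≤ b) (x : ℝ) {h y : ℝ} (hh : 0 < h) (hy : 0 < y) (hyh : y ≤ h) :
    μ.real (Metric.closedBall x h) / (5 * h) ≤
      (herglotzFn μ a b (x + (y + h : ℝ) * Complex.I)).im := by
  have := isLocallyFiniteMeasure_of_integrable_inv_sq_add_one hμ
  obtain ⟨h1, h2⟩ := integrable_poisson_kernel hμ x (add_pos hy hh)
  rw [h2 a b]
  have hfin : μ (Metric.closedBall x h) ≠ ⊤ := (isCompact_closedBall x h).measure_lt_top.ne
  have hpos : ∀ s : ℝ, 0 ≤ (y + h) / ((s - x) ^ 2 + (y + h) ^ 2) := fun s => by positivity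
  calc μ.real (Metric.closedBall x h) / (5 * h)
      = ∫ s in Metric.closedBall x h, (5 * h)⁻¹ ∂μ := by
        rw [setIntegral_const, smul_eq_mul, div_eq_mul_inv]
    _ ≤ ∫ s in Metric.closedBall x h, (y + h) / ((s - x) ^ 2 + (y + h) ^ 2) ∂μ := by
        refine setIntegral_mono_on (integrableOn_const hfin) h1.integrableOn
          measurableSet_closedBall fun s hs => ?_
        rw [Metric.mem_closedBall, Real.dist_eq] at hs
        have h3 := sq_le_sq' (abs_le.1 hs).1 (abs_le.1 hs).2
        rw [inv_eq_one_div, div_le_div_iff₀ (by positivity) (by positivity)]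
        nlinarith
    _ ≤ ∫ s, (y + h) / ((s - x) ^ 2 + (y + h) ^ 2) ∂μ :=
        setIntegral_le_integral h1 (Eventually.of_forall hpos)
    _ ≤ _ := le_add_of_nonneg_left (by positivity)

theorem volume_le_of_isCompact_of_tendsto_re_zero {μ : Measure ℝ}
    (hμ : Integrable (fun t : ℝ => (t ^ 2 + 1)⁻¹) μ) (a : ℝ) {b : ℝ} (hb : 0 ≤ b)
    {x h η : ℝ} (hh : 0 < h) (hη : 0 < η) {A : Set ℝ} (hA : IsCompact A)
    (hAx : A ⊆ Metric.closedBall x h) (hpos : 0 < μ (Metric.closedBall x h))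
    (hre : ∀ᵐ t : ℝ ∂(volume.restrict A),
      Tendsto (fun y : ℝ => (herglotzFn μ a b ((t : ℂ) + y * Complex.I)).re)
        (𝓝[>] (0 : ℝ)) (𝓝 0)) :
    volume A ≤ ENNReal.ofReal (Real.pi * h / η) * (μ A / μ (Metric.closedBall x h)) +
      ENNReal.ofReal (4 * Real.pi * h * √(10 * η)) := by
  have := isLocallyFiniteMeasure_of_integrable_inv_sq_add_one hμ
  have hfin : μ (Metric.closedBall x h) ≠ ⊤ := (isCompact_closedBall x h).measure_lt_top.ne
  have hμ0 : μ ≠ 0 := by rintro rfl; simp at hpos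
  set m := μ.real (Metric.closedBall x h) with hm
  have hm0 : 0 < m := ENNReal.toReal_pos hpos.ne' hfin
  have hmof : μ (Metric.closedBall x h) = ENNReal.ofReal m := (ENNReal.ofReal_toReal hfin).symm
  set l := η * m / h with hl
  have hl0 : 0 < l := by positivity
  set f := herglotzFn μ a b with hf
  have hfc : ∀ y : ℝ, 0 < y → Continuous fun t : ℝ => f (t + y * Complex.I) := fun y hy =>
    continuous_iff_continuousAt.2 fun t => ContinuousAt.comp
      (f := fun t : ℝ => (t : ℂ) + y * Complex.I)
      (differentiableAt_herglotzFn hμ a b (by simpa using hy)).continuousAt (by fun_prop)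
  obtain ⟨e, he, hle⟩ := exists_tendsto_zero_lintegral_im_herglotzFn_le hμ a hb hA
  set u : ℕ → ℝ := fun n => 1 / ((n : ℝ) + 1) with hu
  have hu0 : ∀ n, 0 < u n := fun n => by positivity
  have hulim : Tendsto u atTop (𝓝[>] 0) :=
    tendsto_nhdsWithin_iff.2 ⟨tendsto_one_div_add_atTop_nhds_zero_nat, Eventually.of_forall hu0⟩
  set T : ℕ → ENNReal := fun n =>
    volume.restrict A {t : ℝ | ENNReal.ofReal l ≤ edist (f (t + u n * Complex.I)).re 0} with hT
  have hTlim : Tendsto T atTop (𝓝 0) := by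
    have : IsFiniteMeasure (volume.restrict A) := ⟨by simpa using hA.measure_lt_top⟩
    refine tendstoInMeasure_of_tendsto_ae (μ := volume.restrict A)
      (f := fun n t => (f (t + u n * Complex.I)).re) (g := fun _ => 0)
      (fun n => (Complex.continuous_re.comp (hfc _ (hu0 n))).aestronglyMeasurable) ?_
      (ENNReal.ofReal l) (ENNReal.ofReal_pos.2 hl0)
    filter_upwards [hre] with t ht using ht.comp hulim
  have hmain : ∀ᶠ n in atTop, volume A ≤ (ENNReal.ofReal l)⁻¹ *
      (ENNReal.ofReal Real.pi * μ A + e (u n)) + T n +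
        ENNReal.ofReal (4 * Real.pi * h * √(10 * η)) := by
    have huh : ∀ᶠ n in atTop, u n ≤ h :=
      (hulim.mono_right nhdsWithin_le_nhds).eventually_le_const hh
    filter_upwards [huh] with n hn
    have hsub : A ⊆ ({t ∈ A | ENNReal.ofReal l ≤ ENNReal.ofReal (f (t + u n * Complex.I)).im} ∪
        ({t : ℝ | ENNReal.ofReal l ≤ edist (f (t + u n * Complex.I)).re 0} ∩ A)) ∪
        {t ∈ Metric.closedBall x h | ‖f (t + u n * Complex.I)‖ ≤ 2 * l} := by
      intro t ht
      by_contra hcon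
      simp only [Set.mem_union, Set.mem_ofPred_eq, Set.mem_inter_iff, ht, hAx ht, true_and, and_true,
        not_or, not_le] at hcon
      obtain ⟨⟨h1, h2⟩, h3⟩ := hcon
      have him : 0 < (f (t + u n * Complex.I)).im :=
        im_herglotzFn_pos hμ hμ0 a hb (by simpa using hu0 n)
      rw [ENNReal.ofReal_lt_ofReal_iff hl0] at h1
      rw [edist_dist, ENNReal.ofReal_lt_ofReal_iff hl0, Real.dist_0_eq_abs] at h2
      have h4 := Complex.norm_le_abs_re_add_abs_im (f (t + u n * Complex.I))
      rw [abs_of_pos him] at h4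
      linarith
    refine (measure_mono hsub).trans ((measure_union_le _ _).trans
      (add_le_add ((measure_union_le _ _).trans (add_le_add ?_ ?_)) ?_))
    · rw [← ENNReal.div_eq_inv_mul]
      refine le_trans ?_ (ENNReal.div_le_div_right (hle _ (hu0 n)) _)
      refine le_trans ?_ (meas_ge_le_lintegral_div (μ := volume.restrict A)
        (f := fun t : ℝ => ENNReal.ofReal (f (t + u n * Complex.I)).im)
        (ENNReal.continuous_ofReal.comp (Complex.continuous_im.comp (hfc _ (hu0 n)))).aemeasurable
        (ENNReal.ofReal_pos.2 hl0).ne' ENNReal.ofReal_ne_top)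
      rw [Measure.restrict_apply' hA.measurableSet]
      exact measure_mono fun t ht => ⟨ht.2, ht.1⟩
    · simp only [hT]
      rw [Measure.restrict_apply' hA.measurableSet]
    · refine (volume_closedBall_inter_norm_le_le
        (fun z hz => differentiableAt_herglotzFn hμ a b hz)
        (fun z hz => im_herglotzFn_pos hμ hμ0 a hb hz) x hh (hu0 n)
        (by positivity : 0 < 2 * l)).trans ?_
      refine ENNReal.ofReal_le_ofReal ?_
      gcongr
      have h1 := le_im_herglotzFn hμ a hb x hh (hu0 n) hn
      rw [← hm] at h1
      calc _ ≤ 2 * l / (m / (5 * h)) := by gcongr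
        _ = _ := by rw [hl]; field_simp; norm_num
  have hlim : Tendsto (fun n => (ENNReal.ofReal l)⁻¹ *
      (ENNReal.ofReal Real.pi * μ A + e (u n)) + T n +
        ENNReal.ofReal (4 * Real.pi * h * √(10 * η))) atTop
      (𝓝 ((ENNReal.ofReal l)⁻¹ * (ENNReal.ofReal Real.pi * μ A + 0) + 0 +
        ENNReal.ofReal (4 * Real.pi * h * √(10 * η)))) := by
    refine ((ENNReal.Tendsto.const_mul (tendsto_const_nhds.add (he.comp hulim)) (Or.inr ?_)).add
      hTlim).add tendsto_const_nhds
    exact ENNReal.inv_ne_top.2 (ENNReal.ofReal_pos.2 hl0).ne'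
  refine (ge_of_tendsto hlim hmain).trans (le_of_eq ?_)
  rw [add_zero, add_zero, hmof, ENNReal.div_eq_inv_mul, ← mul_assoc, ← mul_assoc,
    ← ENNReal.ofReal_inv_of_pos hl0, ← ENNReal.ofReal_inv_of_pos hm0,
    ← ENNReal.ofReal_mul (by positivity), ← ENNReal.ofReal_mul (by positivity)]
  congr 3
  rw [hl]
  field_simp

/-- Corollary 2.1: if `E` is weakly homogeneous, i.e.
`limsup_{h→0+} |E ∩ (x-h, x+h)|/(2h) > 0` for every `x ∈ E`, and `μ ∈ R(E)`,
then `μ_s(E) = 0`. -/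
theorem singular_part_vanishes_on_weakly_homogeneous
    (E : Set ℝ) (hE : MeasurableSet E)
    (hweak : ∀ x ∈ E, 0 < Filter.limsup
      (fun h : ℝ => volume (E ∩ Set.Ioo (x - h) (x + h)) / ENNReal.ofReal (2 * h))
      (𝓝[>] (0 : ℝ)))
    (μ : Measure ℝ) (hμ : IsReflectionless μ E) :
    μ.singularPart volume E = 0 := by
  obtain ⟨hμint, a, b, hb, hre⟩ := hμ
  have := isLocallyFiniteMeasure_of_integrable_inv_sq_add_one hμint
  set σ := μ.singularPart volume with hσ
  set ρ := volume.withDensity (μ.rnDeriv volume) with hρ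
  have hadd : σ + ρ = μ := Measure.singularPart_add_rnDeriv μ volume
  have hσle : σ ≤ μ := Measure.singularPart_le μ volume
  have : IsLocallyFiniteMeasure σ := Measure.isLocallyFiniteMeasure_of_le hσle
  have : IsLocallyFiniteMeasure ρ :=
    Measure.isLocallyFiniteMeasure_of_le (Measure.withDensity_rnDeriv_le μ volume)
  have hsing : σ ⟂ₘ volume := Measure.mutuallySingular_singularPart μ volume
  have hρσ : ρ ⟂ₘ σ := (hsing.mono_ac .rfl (withDensity_absolutelyContinuous _ _)).symm
  set N := hsing.symm.nullSet with hN
  have hNm : MeasurableSet N := hsing.symm.measurableSet_nullSet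
  have hN0 : volume N = 0 := hsing.symm.measure_nullSet
  have hσN : σ Nᶜ = 0 := hsing.symm.measure_compl_nullSet
  have hae : ∀ᵐ x ∂σ, x ∉ E := by
    filter_upwards [(Besicovitch.vitaliFamily σ).ae_eventually_measure_pos,
      (Besicovitch.vitaliFamily σ).ae_eventually_measure_zero_of_singular hρσ] with x hx1 hx2 hxE
    replace hx1 := (Besicovitch.tendsto_filterAt σ x).eventually hx1
    replace hx2 := hx2.comp (Besicovitch.tendsto_filterAt σ x)
    have hkey : ∀ η : ℝ, 0 < η → Filter.limsup
        (fun h : ℝ => volume (E ∩ Set.Ioo (x - h) (x + h)) / ENNReal.ofReal (2 * h))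
        (𝓝[>] (0 : ℝ)) ≤ ENNReal.ofReal (2 * Real.pi * √(10 * η)) := by
      intro η hη
      have hlim : Tendsto (fun h : ℝ => ENNReal.ofReal (Real.pi / (2 * η)) *
          (ρ (Metric.closedBall x h) / σ (Metric.closedBall x h)) +
            ENNReal.ofReal (2 * Real.pi * √(10 * η))) (𝓝[>] 0)
          (𝓝 (ENNReal.ofReal (2 * Real.pi * √(10 * η)))) := by
        simpa using (ENNReal.Tendsto.const_mul hx2 (Or.inr ENNReal.ofReal_ne_top)).add
          (tendsto_const_nhds (x := ENNReal.ofReal (2 * Real.pi * √(10 * η))))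
      rw [← hlim.limsup_eq]
      refine limsup_le_limsup ?_
      filter_upwards [hx1, self_mem_nhdsWithin] with h hσpos hh
      replace hh : 0 < h := hh
      rw [ENNReal.div_le_iff (ENNReal.ofReal_pos.2 (by positivity)).ne' ENNReal.ofReal_ne_top]
      have hEN : volume (E ∩ Set.Ioo (x - h) (x + h)) =
          volume ((E ∩ Set.Ioo (x - h) (x + h)) \ N) := (measure_sdiff_null hN0).symm
      rw [hEN, ((hE.inter measurableSet_Ioo).diff hNm).measure_eq_iSup_isCompact]
      refine iSup₂_le fun A hAsub => iSup_le fun hA => ?_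
      have hAball : A ⊆ Metric.closedBall x h := fun t ht => by
        rw [Real.closedBall_eq_Icc]
        exact Set.Ioo_subset_Icc_self (hAsub ht).1.2
      have hμA : μ A ≤ ρ (Metric.closedBall x h) := by
        have : σ A = 0 := measure_mono_null (fun t ht => (hAsub ht).2) hσN
        rw [← hadd, Measure.add_apply, this, zero_add]
        exact measure_mono hAball
      have hvol := volume_le_of_isCompact_of_tendsto_re_zero hμint a hb hh hη hA hAball
        (hσpos.trans_le (hσle _))
        (ae_mono (Measure.restrict_mono (fun t ht => (hAsub ht).1.1) le_rfl) hre)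
      refine hvol.trans ?_
      rw [add_mul, mul_right_comm (ENNReal.ofReal _),
        ← ENNReal.ofReal_mul (show 0 ≤ Real.pi / (2 * η) by positivity),
        ← ENNReal.ofReal_mul (show 0 ≤ 2 * Real.pi * √(10 * η) by positivity)]
      have h1 : Real.pi / (2 * η) * (2 * h) = Real.pi * h / η := by field_simp
      have h2 : 2 * Real.pi * √(10 * η) * (2 * h) = 4 * Real.pi * h * √(10 * η) := by ring
      rw [h1, h2]
      gcongr
    have hzero : Tendsto (fun η : ℝ => ENNReal.ofReal (2 * Real.pi * √(10 * η))) (𝓝[>] 0) (𝓝 0) := by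
      have : Continuous fun η : ℝ => ENNReal.ofReal (2 * Real.pi * √(10 * η)) :=
        ENNReal.continuous_ofReal.comp (by fun_prop)
      simpa using (this.tendsto 0).mono_left nhdsWithin_le_nhds
    exact (hweak x hxE).not_ge (ge_of_tendsto hzero (eventually_mem_nhdsWithin.mono hkey))
  simpa [ae_iff] using hae
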